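/- For every integer n ≥ 3 and all integers i, j with 1 ≤ i < j ≤ n, the number of derangements of {1,…,n} in which j lies in a 2-cycle and i precedes j satisfies 2·#{σ ∈ D_n : σ(σ(j)) = j and σ⁻¹(i) < σ⁻¹(j)} = (n−2)·d_{n−2}. -/

import Mathlib

/-- Number of inversions of a permutation of `Fin n`: the number of pairs of
positions `a < b` with `σ a > σ b`. -/
def inversions {n : ℕ} (σ : Equiv.Perm (Fin n)) : ℕ :=
  ((Finset.univ : Finset (Fin n × Fin n)).filter
    (fun p => p.1 < p.2 ∧ σ p.2 < σ p.1)).card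

/-- The set of derangements (fixed-point-free permutations) of `Fin n`. -/
def derangeSet (n : ℕ) : Finset (Equiv.Perm (Fin n)) :=
  Finset.univ.filter (fun σ => ∀ x, σ x ≠ x)

/-- The number of derangements of `Fin n` (so `numDerange 0 = 1`). -/
def numDerange (n : ℕ) : ℕ := (derangeSet n).card

/-- The number of fixed points of a permutation of `Fin n`. -/
def fixedPointCount {n : ℕ} (σ : Equiv.Perm (Fin n)) : ℕ :=
  (Finset.univ.filter (fun x => σ x = x)).card

/-- The set of permutations of `Fin n` with exactly `k` fixed points. -/
def permsWithFixed (n k : ℕ) : Finset (Equiv.Perm (Fin n)) :=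
  Finset.univ.filter (fun σ => fixedPointCount σ = k)

/-- The number of permutations of `Fin n` with exactly `k` fixed points. -/
def numPermsWithFixed (n k : ℕ) : ℕ := (permsWithFixed n k).card

open Equiv Finset in
/-- The derangements having `(a b)` as a cycle are counted by the derangements of the complement
of `{a, b}`. -/
theorem card_derangements_with_swap {α : Type*} [Fintype α] [DecidableEq α] {a b : α}
    (hab : a ≠ b) :
    #{σ : Perm α | (∀ x, σ x ≠ x) ∧ σ a = b ∧ σ b = a} =
      numDerangements (Fintype.card α - 2) := by
  have hcard : Fintype.card {x : α // x ≠ a ∧ x ≠ b} = Fintype.card α - 2 := by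
    rw [Fintype.card_subtype, ← card_pair hab, ← card_compl]
    congr 1
    ext x
    simp
  rw [← hcard, ← card_derangements_eq_numDerangements,
    Fintype.card_congr (derangements.subtypeEquiv fun x : α => x ≠ a ∧ x ≠ b),
    Fintype.card_subtype]
  refine card_nbij' (swap a b * ·) (swap a b * ·) ?_ ?_ (fun σ _ => by simp) (fun σ _ => by simp)
  · intro σ hσ
    simp only [coe_filter, mem_univ, true_and, Set.mem_ofPred_eq, Function.mem_fixedPoints,
      Function.IsFixedPt, Perm.mul_apply] at hσ ⊢
    obtain ⟨hd, ha, hb⟩ := hσ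
    intro x
    by_cases hxa : x = a
    · simp [hxa, ha]
    by_cases hxb : x = b
    · simp [hxb, hb]
    have h1 : σ x ≠ a := fun h => hxb (σ.injective (h.trans hb.symm))
    have h2 : σ x ≠ b := fun h => hxa (σ.injective (h.trans ha.symm))
    simp [hxa, hxb, swap_apply_of_ne_of_ne h1 h2, hd x]
  · intro σ hσ
    simp only [coe_filter, mem_univ, true_and, Set.mem_ofPred_eq, Function.mem_fixedPoints,
      Function.IsFixedPt, Perm.mul_apply] at hσ ⊢
    have ha : σ a = a := (hσ a).1 (by simp)
    have hb : σ b = b := (hσ b).1 (by simp)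
    refine ⟨fun x => ?_, by simp [ha], by simp [hb]⟩
    by_cases hxa : x = a
    · simp [hxa, ha, hab.symm]
    by_cases hxb : x = b
    · simp [hxb, hb, hab]
    have h1 : σ x ≠ a := fun h => hxa (σ.injective (h.trans ha.symm))
    have h2 : σ x ≠ b := fun h => hxb (σ.injective (h.trans hb.symm))
    rw [swap_apply_of_ne_of_ne h1 h2]
    exact fun h => by simpa [hxa, hxb] using (hσ x).2 h

open Equiv Finset in
/-- Counting the derangements in which `j` lies in a 2-cycle that avoids `i`. -/
theorem card_derangements_two_cycle_avoiding {α : Type*} [Fintype α] [DecidableEq α] {i j : α}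
    (hij : i ≠ j) :
    #{σ : Perm α | (∀ x, σ x ≠ x) ∧ σ (σ j) = j ∧ σ j ≠ i} =
      (Fintype.card α - 2) * numDerangements (Fintype.card α - 2) := by
  have hcompl : #({i, j}ᶜ : Finset α) = Fintype.card α - 2 := by
    rw [card_compl, card_pair hij]
  rw [card_eq_sum_card_fiberwise (f := fun σ => σ j) (t := {i, j}ᶜ)]
  · rw [← hcompl, ← smul_eq_mul]
    refine sum_const_nat fun k hk => ?_
    simp only [mem_compl, mem_insert, mem_singleton, not_or] at hk
    rw [hcompl, ← card_derangements_with_swap (Ne.symm hk.2), filter_filter]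
    congr 1
    ext σ
    simp only [mem_filter, mem_univ, true_and]
    constructor
    · rintro ⟨⟨hd, h, -⟩, rfl⟩
      exact ⟨hd, rfl, h⟩
    · rintro ⟨hd, rfl, h⟩
      exact ⟨⟨hd, h, hk.1⟩, rfl⟩
  · intro σ hσ
    simp only [coe_filter, mem_univ, true_and, Set.mem_ofPred_eq] at hσ
    simp [hσ.2.2, hσ.1 j]

open Equiv in
/-- Conjugate `σ` by the transposition of the preimages of `i` and `j`. -/
def swapPreimages {α : Type*} [DecidableEq α] (i j : α) (σ : Perm α) : Perm α :=
  swap (σ⁻¹ i) (σ⁻¹ j) * σ * swap (σ⁻¹ i) (σ⁻¹ j)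

open Equiv in
theorem swapPreimages_spec {α : Type*} [DecidableEq α] {i j : α} (hij : i ≠ j) {σ : Perm α}
    (hd : ∀ x, σ x ≠ x) (h2 : σ (σ j) = j) (hi : σ j ≠ i) :
    (∀ x, swapPreimages i j σ x ≠ x) ∧
      swapPreimages i j σ (swapPreimages i j σ j) = j ∧ swapPreimages i j σ j ≠ i ∧
      (swapPreimages i j σ)⁻¹ i = σ⁻¹ j ∧ (swapPreimages i j σ)⁻¹ j = σ⁻¹ i := by
  obtain ⟨l, rfl⟩ : ∃ l, i = σ l := ⟨σ⁻¹ i, by simp⟩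
  obtain ⟨k, rfl⟩ : ∃ k, j = σ k := ⟨σ⁻¹ j, by simp⟩
  have hk : σ (σ k) = k := σ.injective h2
  have hτ : swapPreimages (σ l) (σ k) σ = swap l k * σ * swap l k := by simp [swapPreimages]
  have hlk : l ≠ k := fun h => hij (by rw [h])
  have hjl : σ k ≠ l := fun h => hi (by rw [h])
  have hil : σ l ≠ k := fun h => hi (by rw [hk, h])
  have hsj : swap l k (σ k) = σ k := swap_apply_of_ne_of_ne hjl (hd k)
  have hsi : swap l k (σ l) = σ l := swap_apply_of_ne_of_ne (hd l) hil
  rw [hτ]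
  refine ⟨fun x hx => ?_, ?_, ?_, ?_, ?_⟩
  · apply hd (swap l k x)
    rw [← (swap l k).injective.eq_iff, swap_apply_self]
    exact hx
  · simp [hsj, hk]
  · simpa [hsj, hk] using (hd l).symm
  · rw [Perm.inv_eq_iff_eq]
    simp [hsi]
  · rw [Perm.inv_eq_iff_eq]
    simp [hsj]

open Equiv in
theorem swapPreimages_swapPreimages {α : Type*} [DecidableEq α] {i j : α} (hij : i ≠ j)
    {σ : Perm α} (hd : ∀ x, σ x ≠ x) (h2 : σ (σ j) = j) (hi : σ j ≠ i) :
    swapPreimages i j (swapPreimages i j σ) = σ := by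
  obtain ⟨-, -, -, h3, h4⟩ := swapPreimages_spec hij hd h2 hi
  rw [swapPreimages, h3, h4, swapPreimages, swap_comm (σ⁻¹ j)]
  ext x
  simp

open Equiv Finset in
/-- Among the derangements in which `j` lies in a 2-cycle avoiding `i`, exactly half have `i`
preceding `j`. -/
theorem two_mul_card_derangements_inv_lt_inv {α : Type*} [Fintype α] [LinearOrder α] {i j : α}
    (hij : i < j) :
    2 * #{σ : Perm α | (∀ x, σ x ≠ x) ∧ σ (σ j) = j ∧ σ⁻¹ i < σ⁻¹ j} =
      (Fintype.card α - 2) * numDerangements (Fintype.card α - 2) := by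
  set A : Finset (Perm α) := {σ | (∀ x, σ x ≠ x) ∧ σ (σ j) = j ∧ σ j ≠ i} with hA
  have hmem {σ : Perm α} : σ ∈ A ↔ (∀ x, σ x ≠ x) ∧ σ (σ j) = j ∧ σ j ≠ i := by simp [hA]
  have hlt : ({σ : Perm α | (∀ x, σ x ≠ x) ∧ σ (σ j) = j ∧ σ⁻¹ i < σ⁻¹ j} : Finset _) =
      A.filter fun σ => σ⁻¹ i < σ⁻¹ j := by
    ext σ
    simp only [mem_filter, mem_univ, true_and, hmem, and_assoc]
    refine and_congr_right fun hd => and_congr_right fun h2 => ?_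
    refine (and_iff_right_of_imp fun h hi => ?_).symm
    have h3 : σ⁻¹ i = j := by rw [Perm.inv_eq_iff_eq, hi]
    have h4 : σ⁻¹ j = i := by rw [Perm.inv_eq_iff_eq, ← hi, h2]
    exact absurd h (by rw [h3, h4]; exact hij.le.not_gt)
  have hhalf : #(A.filter fun σ => σ⁻¹ i < σ⁻¹ j) = #(A.filter fun σ => ¬ σ⁻¹ i < σ⁻¹ j) := by
    refine card_nbij' (swapPreimages i j) (swapPreimages i j) ?_ ?_ ?_ ?_
    · intro σ hσ
      simp only [coe_filter, Set.mem_ofPred_eq, hmem] at hσ ⊢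
      obtain ⟨⟨hd, h2, hi⟩, hl⟩ := hσ
      obtain ⟨h1, h2, h3, h4, h5⟩ := swapPreimages_spec hij.ne hd h2 hi
      exact ⟨⟨h1, h2, h3⟩, by rw [h4, h5]; exact hl.le.not_gt⟩
    · intro σ hσ
      simp only [coe_filter, Set.mem_ofPred_eq, hmem] at hσ ⊢
      obtain ⟨⟨hd, h2, hi⟩, hl⟩ := hσ
      obtain ⟨h1, h2, h3, h4, h5⟩ := swapPreimages_spec hij.ne hd h2 hi
      refine ⟨⟨h1, h2, h3⟩, ?_⟩
      rw [h4, h5]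
      exact lt_of_le_of_ne (not_lt.1 hl) fun h => hij.ne' (σ⁻¹.injective h)
    all_goals
      intro σ hσ
      simp only [coe_filter, Set.mem_ofPred_eq, hmem] at hσ
      exact swapPreimages_swapPreimages hij.ne hσ.1.1 hσ.1.2.1 hσ.1.2.2
  rw [hlt, ← card_derangements_two_cycle_avoiding hij.ne, ← hA,
    ← card_filter_add_card_filter_not (s := A) (fun σ => σ⁻¹ i < σ⁻¹ j), ← hhalf, two_mul]

theorem numDerange_eq_numDerangements (n : ℕ) : numDerange n = numDerangements n := by
  rw [← card_derangements_fin_eq_numDerangements, Fintype.card_subtype, numDerange, derangeSet]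
  congr 1
  ext σ
  rw [Finset.mem_filter_univ, Finset.mem_filter_univ]
  exact Iff.rfl

/-- The number of derangements of `{1,…,n}` in which `j` lies in a 2-cycle and `i`
precedes `j` satisfies `2 · # = (n-2) · d_{n-2}`. -/
theorem stmt13 (n i j : ℕ) (hn : 3 ≤ n) (hi : 1 ≤ i) (hij : i < j) (hj : j ≤ n) :
    2 * ((derangeSet n).filter
        (fun σ => σ (σ (⟨j - 1, by omega⟩ : Fin n)) = (⟨j - 1, by omega⟩ : Fin n) ∧
          σ⁻¹ (⟨i - 1, by omega⟩ : Fin n) < σ⁻¹ (⟨j - 1, by omega⟩ : Fin n))).card =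
      (n - 2) * numDerange (n - 2) := by
  have hlt : (⟨i - 1, by omega⟩ : Fin n) < ⟨j - 1, by omega⟩ := Fin.mk_lt_mk.2 (by omega)
  have h := two_mul_card_derangements_inv_lt_inv hlt
  rw [Fintype.card_fin] at h
  rw [numDerange_eq_numDerangements, ← h, derangeSet, Finset.filter_filter]
  congr!
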